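/- arXiv:1811.08937 — 3 statements merged into one kernel-verified Lean document; each statement's English description precedes it below -/
import Mathlib

section
/- Let f : ℝ^n → ℝ ∪ {+∞} and g : ℝ^m → ℝ ∪ {+∞} be proper closed convex, A ∈ ℝ^{m×n}, and let M1 ∈ ℝ^{n×n}, M2 ∈ ℝ^{m×m} be symmetric positive definite such that the block matrix M̃ = [[M1, −A^T], [−A, M2]] is positive semidefinite. Let (x^k, z^k), k = 0,…,N, be generated by PrePDHG: x^{k+1} = argmin_x { f(x) + ⟨x − x^k, A^T z^k⟩ + ½‖x − x^k‖²_{M1} }, z^{k+1} = argmin_z { g*(z) − ⟨z − z^k, A(2x^{k+1} − x^k)⟩ + ½‖z − z^k‖²_{M2} }. Then for every x ∈ ℝ^n and z ∈ ℝ^m, φ(X^N, z) − φ(x, Z^N) ≤ (1/(2N)) [ ‖x − x^0‖²_{M1} − 2⟨z − z^0, A(x − x^0)⟩ + ‖z − z^0‖²_{M2} ], where X^N = (1/N)∑_{i=1}^N x^i and Z^N = (1/N)∑_{i=1}^N z^i. -/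
open Matrix Filter

noncomputable section

/-- Euclidean norm of a vector. -/
def nrm {ι : Type*} [Fintype ι] (x : ι → ℝ) : ℝ := Real.sqrt (x ⬝ᵥ x)

/-- A function into the extended reals is proper: never `⊥` and somewhere finite. -/
def ProperE {ι : Type*} (f : (ι → ℝ) → EReal) : Prop :=
  (∃ x, f x ≠ ⊤) ∧ ∀ x, f x ≠ ⊥

/-- Convexity of an extended-real-valued function. -/
def ConvexE {ι : Type*} (f : (ι → ℝ) → EReal) : Prop :=
  ∀ x y : ι → ℝ, ∀ t : ℝ, 0 ≤ t → t ≤ 1 →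
    f (t • x + (1 - t) • y) ≤ (t : EReal) * f x + ((1 - t : ℝ) : EReal) * f y

/-- `μ`-strong convexity of an extended-real-valued function. -/
def StrongConvexE {ι : Type*} [Fintype ι] (μ : ℝ) (f : (ι → ℝ) → EReal) : Prop :=
  ∀ x y : ι → ℝ, ∀ t : ℝ, 0 ≤ t → t ≤ 1 →
    f (t • x + (1 - t) • y) + ((μ / 2 * (t * (1 - t)) * ((x - y) ⬝ᵥ (x - y)) : ℝ) : EReal) ≤
      (t : EReal) * f x + ((1 - t : ℝ) : EReal) * f y

/-- Fenchel conjugate. -/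
def conjE {ι : Type*} [Fintype ι] (f : (ι → ℝ) → EReal) (y : ι → ℝ) : EReal :=
  ⨆ x : ι → ℝ, ((x ⬝ᵥ y : ℝ) : EReal) - f x

/-- `v` is a subgradient of `f` at `x`. -/
def SubgradAt {ι : Type*} [Fintype ι] (f : (ι → ℝ) → EReal) (x v : ι → ℝ) : Prop :=
  ∀ z, f x + (((z - x) ⬝ᵥ v : ℝ) : EReal) ≤ f z

/-- `p = prox^M_φ(x)`: `p` minimizes `φ(·) + ½‖· − x‖²_M`. -/
def IsProxPt {ι : Type*} [Fintype ι] (M : Matrix ι ι ℝ) (φ : (ι → ℝ) → EReal)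
    (x p : ι → ℝ) : Prop :=
  ∀ w, φ p + (((1 / 2 : ℝ) * ((p - x) ⬝ᵥ M.mulVec (p - x)) : ℝ) : EReal) ≤
       φ w + (((1 / 2 : ℝ) * ((w - x) ⬝ᵥ M.mulVec (w - x)) : ℝ) : EReal)

/-- Smallest eigenvalue of a symmetric matrix, via the Rayleigh quotient. -/
def lamMin {ι : Type*} [Fintype ι] (M : Matrix ι ι ℝ) : ℝ :=
  sInf {r | ∃ v : ι → ℝ, v ⬝ᵥ v = 1 ∧ r = v ⬝ᵥ M.mulVec v}

/-- Largest eigenvalue of a symmetric matrix, via the Rayleigh quotient. -/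
def lamMax {ι : Type*} [Fintype ι] (M : Matrix ι ι ℝ) : ℝ :=
  sSup {r | ∃ v : ι → ℝ, v ⬝ᵥ v = 1 ∧ r = v ⬝ᵥ M.mulVec v}

/-- Spectral (operator 2-) norm of a matrix. -/
def specNorm {ι κ : Type*} [Fintype ι] [Fintype κ] (A : Matrix ι κ ℝ) : ℝ :=
  sSup {r | ∃ v : κ → ℝ, v ⬝ᵥ v = 1 ∧ r = nrm (A.mulVec v)}

/-- The real epigraph of an extended-real-valued function. -/
def realEpigraph {ι : Type*} (φ : (ι → ℝ) → EReal) : Set ((ι → ℝ) × ℝ) :=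
  {p | φ p.1 ≤ (p.2 : EReal)}

lemma ConvexE.convex_realEpigraph {ι : Type*} {φ : (ι → ℝ) → EReal} (h : ConvexE φ) :
    Convex ℝ (realEpigraph φ) := by
  rintro ⟨x, r⟩ hx ⟨y, s⟩ hy a b ha hb hab
  obtain rfl : b = 1 - a := by linarith
  have hx' : φ x ≤ (r : EReal) := hx
  have hy' : φ y ≤ (s : EReal) := hy
  change φ (a • x + (1 - a) • y) ≤ ((a * r + (1 - a) * s : ℝ) : EReal)
  refine (h x y a ha (by linarith)).trans ?_
  rw [EReal.coe_add, EReal.coe_mul, EReal.coe_mul]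
  exact add_le_add (mul_le_mul_of_nonneg_left hx' (EReal.coe_nonneg.2 ha))
    (mul_le_mul_of_nonneg_left hy' (EReal.coe_nonneg.2 hb))

lemma conjE_le_coe_iff {ι : Type*} [Fintype ι] {g : (ι → ℝ) → EReal} (hg : ∀ x, g x ≠ ⊥)
    (y : ι → ℝ) (r : ℝ) :
    conjE g y ≤ (r : EReal) ↔ ∀ (x : ι → ℝ) (s : ℝ), g x = s → x ⬝ᵥ y - s ≤ r := by
  rw [conjE, iSup_le_iff]
  refine forall_congr' fun x => ?_
  have hx := hg x
  induction h : g x with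
  | bot => exact absurd h hx
  | top => simp
  | coe s =>
    rw [← EReal.coe_sub, EReal.coe_le_coe_iff]
    exact ⟨fun h t ht => EReal.coe_injective ht ▸ h, fun h => h s rfl⟩

lemma convex_realEpigraph_conjE {ι : Type*} [Fintype ι] {g : (ι → ℝ) → EReal}
    (hg : ∀ x, g x ≠ ⊥) : Convex ℝ (realEpigraph (conjE g)) := by
  rintro ⟨y, r⟩ hy ⟨w, q⟩ hw a b ha hb hab
  have hy' := (conjE_le_coe_iff hg y r).1 hy
  have hw' := (conjE_le_coe_iff hg w q).1 hw
  refine (conjE_le_coe_iff hg _ _).2 fun x s hs => ?_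
  simp only [Prod.smul_mk, Prod.mk_add_mk, dotProduct_add, dotProduct_smul, smul_eq_mul]
  have h1 := mul_le_mul_of_nonneg_left (hy' x s hs) ha
  have h2 := mul_le_mul_of_nonneg_left (hw' x s hs) hb
  have h3 : s = a * s + b * s := by rw [← add_mul, hab, one_mul]
  linarith

lemma conjE_ne_bot {ι : Type*} [Fintype ι] {g : (ι → ℝ) → EReal} (hg : ProperE g)
    (y : ι → ℝ) : conjE g y ≠ ⊥ := by
  obtain ⟨⟨x, hx⟩, hbot⟩ := hg
  intro h
  have h1 : ((x ⬝ᵥ y : ℝ) : EReal) - g x ≤ ⊥ :=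
    h ▸ le_iSup (fun x : ι → ℝ => ((x ⬝ᵥ y : ℝ) : EReal) - g x) x
  lift g x to ℝ using ⟨hx, hbot x⟩ with s
  exact EReal.coe_ne_bot (x ⬝ᵥ y - s) (le_bot_iff.1 h1)

/-- Jensen's inequality for a uniform average. -/
lemma le_average_of_convex_realEpigraph {ι : Type*} {φ : (ι → ℝ) → EReal}
    (hφ : Convex ℝ (realEpigraph φ)) {N : ℕ} (hN : 0 < N) (p : ℕ → ι → ℝ) (a : ℕ → ℝ)
    (ha : ∀ i, φ (p i) = a i) :
    φ ((N : ℝ)⁻¹ • ∑ i ∈ Finset.range N, p i) ≤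
      (((N : ℝ)⁻¹ * ∑ i ∈ Finset.range N, a i : ℝ) : EReal) := by
  have hN' : (N : ℝ) ≠ 0 := by positivity
  have h := hφ.sum_mem (t := Finset.range N) (w := fun _ => (N : ℝ)⁻¹)
    (z := fun i => (p i, a i)) (fun _ _ => by positivity) (by simp [hN'])
    (fun i _ => (ha i).le)
  rw [← Finset.smul_sum] at h
  simpa [realEpigraph, Prod.fst_sum, Prod.snd_sum] using h

lemma dotProduct_mulVec_comm_of_transpose_eq {ι : Type*} [Fintype ι] {M : Matrix ι ι ℝ}
    (hM : Mᵀ = M) (u v : ι → ℝ) : u ⬝ᵥ M *ᵥ v = v ⬝ᵥ M *ᵥ u := by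
  rw [dotProduct_mulVec, ← mulVec_transpose, hM, dotProduct_comm]

/-- The first-order optimality condition for minimizing the sum of a convex function,
a linear form and a quadratic form. -/
lemma le_add_dotProduct_of_forall_le {ι : Type*} [Fintype ι] {φ : (ι → ℝ) → EReal}
    (hφ : Convex ℝ (realEpigraph φ)) {M : Matrix ι ι ℝ} (hM : Mᵀ = M) {c v p : ι → ℝ}
    (hp : ∀ w, φ p + (((p - c) ⬝ᵥ v + (1 / 2 : ℝ) * ((p - c) ⬝ᵥ M *ᵥ (p - c)) : ℝ) : EReal) ≤
      φ w + (((w - c) ⬝ᵥ v + (1 / 2 : ℝ) * ((w - c) ⬝ᵥ M *ᵥ (w - c)) : ℝ) : EReal))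
    {w : ι → ℝ} {a b : ℝ} (ha : φ p = a) (hb : φ w = b) :
    a ≤ b + (w - p) ⬝ᵥ (v + M *ᵥ (p - c)) := by
  set d := w - p with hd
  have key : ∀ t : ℝ, 0 < t → t ≤ 1 →
      a ≤ b + d ⬝ᵥ (v + M *ᵥ (p - c)) + t * (1 / 2 * (d ⬝ᵥ M *ᵥ d)) := by
    intro t ht ht1
    have hconv : φ ((1 - t) • p + t • w) ≤ (((1 - t) * a + t * b : ℝ) : EReal) :=
      hφ (x := (p, a)) ha.le (y := (w, b)) hb.le (by linarith) ht.le (by ring)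
    have h := (hp ((1 - t) • p + t • w)).trans (add_le_add_left hconv _)
    rw [ha, ← EReal.coe_add, ← EReal.coe_add, EReal.coe_le_coe_iff] at h
    have hw : (1 - t) • p + t • w - c = (p - c) + t • d := by
      rw [hd]; module
    rw [hw] at h
    have hs := dotProduct_mulVec_comm_of_transpose_eq hM d (p - c)
    simp only [add_dotProduct, mulVec_add, dotProduct_add, mulVec_smul, smul_dotProduct,
      dotProduct_smul, smul_eq_mul] at h ⊢
    rw [← hs] at h
    refine le_of_mul_le_mul_left ?_ ht
    linarith
  have hlim : Tendsto (fun t : ℝ => b + d ⬝ᵥ (v + M *ᵥ (p - c)) + t * (1 / 2 * (d ⬝ᵥ M *ᵥ d)))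
      (nhdsWithin 0 (Set.Ioi 0)) (nhds (b + d ⬝ᵥ (v + M *ᵥ (p - c)))) := by
    have : Continuous fun t : ℝ =>
        b + d ⬝ᵥ (v + M *ᵥ (p - c)) + t * (1 / 2 * (d ⬝ᵥ M *ᵥ d)) := by fun_prop
    simpa using (this.tendsto 0).mono_left nhdsWithin_le_nhds
  refine ge_of_tendsto hlim ?_
  filter_upwards [Ioc_mem_nhdsGT (zero_lt_one' ℝ)] with t ht
  exact key t ht.1 ht.2

/-- The quadratic form of the block matrix `[[M1, −Aᵀ], [−A, M2]]`. -/
def pdhgForm {n m : ℕ} (A : Matrix (Fin m) (Fin n) ℝ) (M1 : Matrix (Fin n) (Fin n) ℝ)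
    (M2 : Matrix (Fin m) (Fin m) ℝ) (u : Fin n → ℝ) (v : Fin m → ℝ) : ℝ :=
  u ⬝ᵥ M1 *ᵥ u - 2 * (v ⬝ᵥ A *ᵥ u) + v ⬝ᵥ M2 *ᵥ v

lemma dotProduct_transpose_mulVec_comm {n m : ℕ} (A : Matrix (Fin m) (Fin n) ℝ)
    (u : Fin n → ℝ) (v : Fin m → ℝ) : u ⬝ᵥ Aᵀ *ᵥ v = v ⬝ᵥ A *ᵥ u := by
  rw [mulVec_transpose, dotProduct_comm, ← dotProduct_mulVec]

lemma pdhgForm_nonneg {n m : ℕ} {A : Matrix (Fin m) (Fin n) ℝ}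
    {M1 : Matrix (Fin n) (Fin n) ℝ} {M2 : Matrix (Fin m) (Fin m) ℝ}
    (hM : (Matrix.fromBlocks M1 (-Aᵀ) (-A) M2).PosSemidef) (u : Fin n → ℝ) (v : Fin m → ℝ) :
    0 ≤ pdhgForm A M1 M2 u v := by
  have h := hM.dotProduct_mulVec_nonneg (Sum.elim u v)
  rw [star_trivial, fromBlocks_mulVec, sumElim_dotProduct_sumElim] at h
  simp only [Sum.elim_comp_inl, Sum.elim_comp_inr, neg_mulVec, dotProduct_add, dotProduct_neg,
    dotProduct_transpose_mulVec_comm] at h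
  rw [pdhgForm]
  linarith

/-- The three-point identity for the block quadratic form. -/
lemma pdhgForm_three_point {n m : ℕ} {A : Matrix (Fin m) (Fin n) ℝ}
    {M1 : Matrix (Fin n) (Fin n) ℝ} {M2 : Matrix (Fin m) (Fin m) ℝ}
    (hM1 : M1ᵀ = M1) (hM2 : M2ᵀ = M2) (x x₀ x₁ : Fin n → ℝ) (z z₀ z₁ : Fin m → ℝ) :
    (x - x₁) ⬝ᵥ (Aᵀ *ᵥ z₀ + M1 *ᵥ (x₁ - x₀)) +
      (z - z₁) ⬝ᵥ (-(A *ᵥ ((2 : ℝ) • x₁ - x₀)) + M2 *ᵥ (z₁ - z₀)) +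
      A *ᵥ x₁ ⬝ᵥ z - A *ᵥ x ⬝ᵥ z₁ =
    1 / 2 * (pdhgForm A M1 M2 (x - x₀) (z - z₀) - pdhgForm A M1 M2 (x - x₁) (z - z₁) -
      pdhgForm A M1 M2 (x₁ - x₀) (z₁ - z₀)) := by
  simp only [pdhgForm, mulVec_sub, mulVec_smul, dotProduct_sub, sub_dotProduct, dotProduct_add,
    dotProduct_neg, dotProduct_smul, smul_eq_mul, dotProduct_transpose_mulVec_comm]
  rw [dotProduct_comm (A *ᵥ x₁) z, dotProduct_comm (A *ᵥ x) z₁,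
    dotProduct_mulVec_comm_of_transpose_eq hM1 x₀ x,
    dotProduct_mulVec_comm_of_transpose_eq hM1 x₁ x,
    dotProduct_mulVec_comm_of_transpose_eq hM1 x₁ x₀,
    dotProduct_mulVec_comm_of_transpose_eq hM2 z₀ z,
    dotProduct_mulVec_comm_of_transpose_eq hM2 z₁ z,
    dotProduct_mulVec_comm_of_transpose_eq hM2 z₁ z₀]
  ring

lemma ne_top_of_add_coe_le {a b : EReal} {r s : ℝ} (h : a + (r : EReal) ≤ b + (s : EReal))
    (hb : b ≠ ⊤) : a ≠ ⊤ := by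
  rintro rfl
  rw [EReal.top_add_coe, top_le_iff] at h
  exact EReal.add_ne_top hb (EReal.coe_ne_top s) h

/-- ergodic convergence of Preconditioned PDHG.  If the block matrix
`M̃ = [[M1, −Aᵀ],[−A, M2]]` is positive semidefinite and `(x^k, z^k)` is generated by
PrePDHG (each update being the exact minimizer of the corresponding subproblem), then
for every `(x, z)` the ergodic saddle gap bound
`φ(X^N, z) − φ(x, Z^N) ≤ (1/(2N))[‖x−x⁰‖²_{M1} − 2⟨z−z⁰, A(x−x⁰)⟩ + ‖z−z⁰‖²_{M2}]` holds,
where `X^N, Z^N` are the averages of the first `N` iterates. -/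
theorem prePDHG_ergodic_convergence {n m : ℕ}
    (f : (Fin n → ℝ) → EReal) (g : (Fin m → ℝ) → EReal)
    (A : Matrix (Fin m) (Fin n) ℝ)
    (hfp : ProperE f) (hfc : LowerSemicontinuous f) (hfv : ConvexE f)
    (hgp : ProperE g) (hgc : LowerSemicontinuous g) (hgv : ConvexE g)
    (hsol : ∃ (X : Fin n → ℝ) (Z : Fin m → ℝ),
      SubgradAt f X (-(Aᵀ.mulVec Z)) ∧ SubgradAt (conjE g) Z (A.mulVec X))
    (M1 : Matrix (Fin n) (Fin n) ℝ) (M2 : Matrix (Fin m) (Fin m) ℝ)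
    (hM1 : M1.PosDef) (hM2 : M2.PosDef)
    (hM : (Matrix.fromBlocks M1 (-Aᵀ) (-A) M2).PosSemidef)
    (x : ℕ → Fin n → ℝ) (z : ℕ → Fin m → ℝ)
    (hx : ∀ k, ∀ w : Fin n → ℝ,
      f (x (k + 1)) + (((x (k + 1) - x k) ⬝ᵥ Aᵀ.mulVec (z k) +
          (1 / 2 : ℝ) * ((x (k + 1) - x k) ⬝ᵥ M1.mulVec (x (k + 1) - x k)) : ℝ) : EReal) ≤
        f w + (((w - x k) ⬝ᵥ Aᵀ.mulVec (z k) +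
          (1 / 2 : ℝ) * ((w - x k) ⬝ᵥ M1.mulVec (w - x k)) : ℝ) : EReal))
    (hz : ∀ k, ∀ w : Fin m → ℝ,
      conjE g (z (k + 1)) + ((-((z (k + 1) - z k) ⬝ᵥ A.mulVec ((2 : ℝ) • x (k + 1) - x k)) +
          (1 / 2 : ℝ) * ((z (k + 1) - z k) ⬝ᵥ M2.mulVec (z (k + 1) - z k)) : ℝ) : EReal) ≤
        conjE g w + ((-((w - z k) ⬝ᵥ A.mulVec ((2 : ℝ) • x (k + 1) - x k)) +
          (1 / 2 : ℝ) * ((w - z k) ⬝ᵥ M2.mulVec (w - z k)) : ℝ) : EReal))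
    (N : ℕ) (hN : 0 < N)
    (XN : Fin n → ℝ) (hXN : XN = (N : ℝ)⁻¹ • ∑ i ∈ Finset.range N, x (i + 1))
    (ZN : Fin m → ℝ) (hZN : ZN = (N : ℝ)⁻¹ • ∑ i ∈ Finset.range N, z (i + 1)) :
    ∀ (xx : Fin n → ℝ) (zz : Fin m → ℝ),
      f XN + ((A.mulVec XN ⬝ᵥ zz : ℝ) : EReal) - conjE g zz ≤
        ((1 / (2 * (N : ℝ)) * ((xx - x 0) ⬝ᵥ M1.mulVec (xx - x 0) -
            2 * ((zz - z 0) ⬝ᵥ A.mulVec (xx - x 0)) +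
            (zz - z 0) ⬝ᵥ M2.mulVec (zz - z 0)) : ℝ) : EReal) +
          (f xx + ((A.mulVec xx ⬝ᵥ ZN : ℝ) : EReal) - conjE g ZN) := by
  intro xx zz
  have hφf := hfv.convex_realEpigraph
  have hφg := convex_realEpigraph_conjE hgp.2
  have hM1' : M1ᵀ = M1 := by simpa using hM1.isHermitian.eq
  have hM2' : M2ᵀ = M2 := by simpa using hM2.isHermitian.eq
  by_cases hzz : conjE g zz = ⊤
  · simp [hzz]
  obtain ⟨x', hx'⟩ := hfp.1
  have hfin : ∀ k, ∃ r : ℝ, f (x (k + 1)) = r := fun k =>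
    ⟨_, (EReal.coe_toReal (ne_top_of_add_coe_le (hx k x') hx') (hfp.2 _)).symm⟩
  have hgin : ∀ k, ∃ r : ℝ, conjE g (z (k + 1)) = r := fun k =>
    ⟨_, (EReal.coe_toReal (ne_top_of_add_coe_le (hz k zz) hzz) (conjE_ne_bot hgp _)).symm⟩
  choose a ha using hfin
  choose b hb using hgin
  have hXle := le_average_of_convex_realEpigraph hφf hN (fun i => x (i + 1)) a ha
  have hZle := le_average_of_convex_realEpigraph hφg hN (fun i => z (i + 1)) b hb
  rw [← hXN] at hXle
  rw [← hZN] at hZle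
  have hXtop := ne_top_of_le_ne_top (EReal.coe_ne_top _) hXle
  have hZtop := ne_top_of_le_ne_top (EReal.coe_ne_top _) hZle
  obtain ⟨F, hF⟩ : ∃ r : ℝ, f XN = r := ⟨_, (EReal.coe_toReal hXtop (hfp.2 _)).symm⟩
  obtain ⟨G, hG⟩ : ∃ r : ℝ, conjE g ZN = r :=
    ⟨_, (EReal.coe_toReal hZtop (conjE_ne_bot hgp _)).symm⟩
  obtain ⟨β, hβ⟩ : ∃ r : ℝ, conjE g zz = r :=
    ⟨_, (EReal.coe_toReal hzz (conjE_ne_bot hgp _)).symm⟩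
  by_cases hxx : f xx = ⊤
  · rw [hxx, hG, EReal.top_add_coe, EReal.top_sub_coe, EReal.coe_add_top]
    exact le_top
  obtain ⟨α, hα⟩ : ∃ r : ℝ, f xx = r := ⟨_, (EReal.coe_toReal hxx (hfp.2 _)).symm⟩
  rw [hF, EReal.coe_le_coe_iff] at hXle
  rw [hG, EReal.coe_le_coe_iff] at hZle
  rw [hF, hG, hα, hβ]
  simp only [← EReal.coe_add, ← EReal.coe_sub, EReal.coe_le_coe_iff]
  set D : ℕ → ℝ := fun k => pdhgForm A M1 M2 (xx - x k) (zz - z k) with hD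
  have hstep : ∀ k, a k + b k + A *ᵥ x (k + 1) ⬝ᵥ zz - A *ᵥ xx ⬝ᵥ z (k + 1) - α - β ≤
      1 / 2 * (D k - D (k + 1)) := by
    intro k
    have h1 := le_add_dotProduct_of_forall_le hφf hM1' (hx k) (ha k) hα
    have h2 := le_add_dotProduct_of_forall_le hφg hM2'
      (v := -(A *ᵥ ((2 : ℝ) • x (k + 1) - x k)))
      (by simpa only [dotProduct_neg] using hz k) (hb k) hβ
    have h3 := pdhgForm_three_point (A := A) hM1' hM2' xx (x k) (x (k + 1)) zz (z k) (z (k + 1))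
    have h4 := pdhgForm_nonneg hM (x (k + 1) - x k) (z (k + 1) - z k)
    simp only [hD]
    linarith
  have hsum := Finset.sum_le_sum fun k (_ : k ∈ Finset.range N) => hstep k
  rw [← Finset.mul_sum, Finset.sum_range_sub'] at hsum
  simp only [Finset.sum_sub_distrib, Finset.sum_add_distrib, Finset.sum_const, Finset.card_range,
    nsmul_eq_mul, ← sum_dotProduct, ← dotProduct_sum, ← mulVec_sum] at hsum
  have hDN : 0 ≤ D N := pdhgForm_nonneg hM _ _
  have hN0 : (0 : ℝ) < N := by exact_mod_cast hN
  have hXs : A *ᵥ XN ⬝ᵥ zz =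
      (N : ℝ)⁻¹ * (A *ᵥ (∑ i ∈ Finset.range N, x (i + 1)) ⬝ᵥ zz) := by
    rw [hXN, mulVec_smul, smul_dotProduct, smul_eq_mul]
  have hZs : A *ᵥ xx ⬝ᵥ ZN =
      (N : ℝ)⁻¹ * (A *ᵥ xx ⬝ᵥ (∑ i ∈ Finset.range N, z (i + 1))) := by
    rw [hZN, dotProduct_smul, smul_eq_mul]
  have hD0 : (xx - x 0) ⬝ᵥ M1 *ᵥ (xx - x 0) - 2 * ((zz - z 0) ⬝ᵥ A *ᵥ (xx - x 0)) +
      (zz - z 0) ⬝ᵥ M2 *ᵥ (zz - z 0) = D 0 := rfl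
  have hgap := mul_le_mul_of_nonneg_left hsum (inv_nonneg.2 hN0.le)
  have hα' : (N : ℝ)⁻¹ * (N * α) = α := inv_mul_cancel_left₀ hN0.ne' α
  have hβ' : (N : ℝ)⁻¹ * (N * β) = β := inv_mul_cancel_left₀ hN0.ne' β
  have hDN' : 0 ≤ (N : ℝ)⁻¹ * D N := by positivity
  have hD0' : 1 / (2 * (N : ℝ)) * D 0 = (N : ℝ)⁻¹ * (1 / 2 * D 0) := by
    field_simp
  rw [hD0, hD0', hXs, hZs]
  linarith
end
end

section
/- Let A ∈ ℝ^{m×n} and τ, σ > 0. The block matrix [[τ^{-1} I_n, −A^T], [−A, σ^{-1} I_m]] is positive semidefinite if and only if 1/(τσ) ≥ ‖A‖², where ‖A‖ is the spectral (operator 2-) norm of A. In particular, the original PDHG stepsize condition 1/(τσ) ≥ ‖A‖² is exactly the positive-semidefiniteness condition on M̃ with preconditioners M1 = τ^{-1} I_n and M2 = σ^{-1} I_m. -/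
open Matrix Filter

noncomputable section

theorem mulVec_dotProduct_self_le {ι κ : Type*} [Fintype ι] [Fintype κ] (A : Matrix ι κ ℝ)
    (v : κ → ℝ) :
    A *ᵥ v ⬝ᵥ A *ᵥ v ≤ (∑ i, ∑ j, A i j ^ 2) * (v ⬝ᵥ v) := by
  simp only [dotProduct, mulVec, ← sq]
  rw [Finset.sum_mul]
  exact Finset.sum_le_sum fun i _ => Finset.sum_mul_sq_le_sq_mul_sq _ _ _

theorem specNorm_sq_le_iff {ι κ : Type*} [Fintype ι] [Fintype κ] (A : Matrix ι κ ℝ) {c : ℝ}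
    (hc : 0 ≤ c) :
    specNorm A ^ 2 ≤ c ↔ ∀ v : κ → ℝ, A *ᵥ v ⬝ᵥ A *ᵥ v ≤ c * (v ⬝ᵥ v) := by
  have hnonneg : 0 ≤ specNorm A := by
    refine Real.sSup_nonneg ?_
    rintro r ⟨v, -, rfl⟩
    exact Real.sqrt_nonneg _
  have hbdd : BddAbove {r | ∃ v : κ → ℝ, v ⬝ᵥ v = 1 ∧ r = nrm (A.mulVec v)} := by
    refine ⟨√(∑ i, ∑ j, A i j ^ 2), ?_⟩
    rintro r ⟨v, hv, rfl⟩
    refine Real.sqrt_le_sqrt ?_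
    simpa [hv] using mulVec_dotProduct_self_le A v
  rw [← Real.le_sqrt hnonneg hc]
  constructor
  · intro h v
    have hnn : 0 ≤ v ⬝ᵥ v := by simpa using dotProduct_star_self_nonneg v
    rcases hnn.eq_or_lt with hv | hv
    · have hv0 : v = 0 := dotProduct_self_eq_zero.mp hv.symm
      simp [hv0]
    · set s := √(v ⬝ᵥ v)
      have hs0 : 0 < s := Real.sqrt_pos.mpr hv
      have hs2 : v ⬝ᵥ v = s ^ 2 := (Real.sq_sqrt hv.le).symm
      have hunit : (s⁻¹ • v) ⬝ᵥ (s⁻¹ • v) = 1 := by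
        rw [smul_dotProduct, dotProduct_smul, hs2]
        simp only [smul_eq_mul]
        field_simp
      have hle : nrm (A *ᵥ (s⁻¹ • v)) ≤ √c := (le_csSup hbdd ⟨_, hunit, rfl⟩).trans h
      rw [nrm, Real.sqrt_le_sqrt_iff hc, mulVec_smul, smul_dotProduct, dotProduct_smul] at hle
      simp only [smul_eq_mul] at hle
      rw [hs2]
      field_simp at hle
      linarith
  · intro h
    refine Real.sSup_le ?_ (Real.sqrt_nonneg c)
    rintro r ⟨v, hv, rfl⟩
    refine Real.sqrt_le_sqrt ?_
    simpa [hv] using h v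

/-- for `τ, σ > 0`, the block matrix `[[τ⁻¹ I_n, −Aᵀ],[−A, σ⁻¹ I_m]]` is
positive semidefinite iff `1/(τσ) ≥ ‖A‖²`, where `‖A‖` is the spectral norm of `A`.
This is exactly the original PDHG stepsize condition. -/
theorem pdhg_stepsize_condition {n m : ℕ}
    (A : Matrix (Fin m) (Fin n) ℝ) (τ σ : ℝ) (hτ : 0 < τ) (hσ : 0 < σ) :
    (Matrix.fromBlocks (τ⁻¹ • (1 : Matrix (Fin n) (Fin n) ℝ)) (-Aᵀ)
        (-A) (σ⁻¹ • (1 : Matrix (Fin m) (Fin m) ℝ))).PosSemidef ↔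
      specNorm A ^ 2 ≤ 1 / (τ * σ) := by
  have hD : (σ⁻¹ • (1 : Matrix (Fin m) (Fin m) ℝ)).PosDef := PosDef.one.smul (inv_pos.mpr hσ)
  have : Invertible (σ⁻¹ • (1 : Matrix (Fin m) (Fin m) ℝ)) := hD.isUnit.invertible
  have hinv : (σ⁻¹ • (1 : Matrix (Fin m) (Fin m) ℝ))⁻¹ = σ • 1 :=
    inv_eq_right_inv (by simp [smul_smul, hσ.ne'])
  have hB : -A = (-Aᵀ)ᴴ := by
    ext; simp
  have hquad (v : Fin n → ℝ) :
      star v ⬝ᵥ (τ⁻¹ • (1 : Matrix (Fin n) (Fin n) ℝ) - σ • (Aᵀ * A)) *ᵥ v =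
        τ⁻¹ * (v ⬝ᵥ v) - σ * (A *ᵥ v ⬝ᵥ A *ᵥ v) := by
    simp [sub_mulVec, smul_mulVec, dotProduct_sub, ← mulVec_mulVec, dotProduct_mulVec,
      vecMul_transpose]
  have hherm : (τ⁻¹ • (1 : Matrix (Fin n) (Fin n) ℝ) - σ • (Aᵀ * A)).IsHermitian := by
    simp [IsHermitian]
  rw [hB, PosDef.fromBlocks₂₂ _ _ hD, ← hB, hinv, specNorm_sq_le_iff A (by positivity)]
  have hschur : τ⁻¹ • (1 : Matrix (Fin n) (Fin n) ℝ) -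
      -Aᵀ * (σ • (1 : Matrix (Fin m) (Fin m) ℝ)) * -A = τ⁻¹ • 1 - σ • (Aᵀ * A) := by simp
  rw [hschur, posSemidef_iff_dotProduct_mulVec]
  simp only [hherm, true_and, hquad, sub_nonneg]
  refine forall_congr' fun v => ?_
  have hscale : τ⁻¹ * (v ⬝ᵥ v) = σ * (1 / (τ * σ) * (v ⬝ᵥ v)) := by field_simp
  rw [hscale, mul_le_mul_iff_right₀ hσ]
end
end

section
/- Let f : ℝ^n → ℝ ∪ {+∞} and g : ℝ^m → ℝ ∪ {+∞} be proper closed convex, A ∈ ℝ^{m×n}, M1, M2 symmetric positive definite, and let (x^k, z^k) be generated by PrePDHG: x^{k+1} = prox^{M1}_f(x^k − M1^{-1}A^T z^k), z^{k+1} = prox^{M2}_{g*}(z^k + M2^{-1}A(2x^{k+1} − x^k)). Define u^k = M1 x^k and y^{k+1} = u^k − A^T z^k − u^{k+1}. Then these sequences satisfy: y^{k+1} = prox^{M1^{-1}}_{f*}(u^k − A^T z^k), u^{k+1} = u^k − A^T z^k − y^{k+1}, and z^{k+1} = prox^{M2}_{g*}( z^k + M2^{-1} A M1^{-1} ( −A^T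 z^k − y^{k+1} + u^{k+1} ) ); that is, PrePDHG is equivalent (under this change of variables) to the preconditioned ADMM-type iteration on the dual problem minimize_z f*(−A^T z) + g*(z). -/
open Matrix Filter

noncomputable section

theorem Matrix.IsSymm.dotProduct_mulVec_comm {ι : Type*} [Fintype ι] {M : Matrix ι ι ℝ}
    (hM : M.IsSymm) (a b : ι → ℝ) : a ⬝ᵥ M *ᵥ b = b ⬝ᵥ M *ᵥ a := by
  rw [dotProduct_mulVec, ← mulVec_transpose, hM.eq, dotProduct_comm]

theorem Matrix.PosDef.isSymm_real {ι : Type*} {M : Matrix ι ι ℝ} (hM : M.PosDef) :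
    M.IsSymm := by
  have h := hM.isHermitian.eq
  rwa [conjTranspose_eq_transpose_of_trivial] at h

/-- A proximal point of a proper function has a finite value. -/
theorem IsProxPt.ne_top {ι : Type*} [Fintype ι] {M : Matrix ι ι ℝ} {φ : (ι → ℝ) → EReal}
    (hφ : ProperE φ) {c p : ι → ℝ} (h : IsProxPt M φ c p) : φ p ≠ ⊤ := by
  obtain ⟨w, hw⟩ := hφ.1
  intro hp
  have h1 := h w
  rw [hp, EReal.top_add_coe, top_le_iff] at h1
  exact EReal.add_ne_top hw (EReal.coe_ne_top _) h1

/-- First-order optimality condition for the proximal point of a proper convex function. -/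
theorem IsProxPt.subgradAt {ι : Type*} [Fintype ι] {M : Matrix ι ι ℝ} (hM : M.IsSymm)
    {φ : (ι → ℝ) → EReal} (hφ : ProperE φ) (hconv : ConvexE φ) {c p : ι → ℝ}
    (h : IsProxPt M φ c p) : SubgradAt φ p (M *ᵥ (c - p)) := by
  intro w
  by_cases hw : φ w = ⊤
  · simp [hw]
  obtain ⟨a, ha⟩ : ∃ a : ℝ, φ p = a :=
    ⟨_, (EReal.coe_toReal (h.ne_top hφ) (hφ.2 p)).symm⟩
  obtain ⟨b, hb⟩ : ∃ b : ℝ, φ w = b := ⟨_, (EReal.coe_toReal hw (hφ.2 w)).symm⟩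
  rw [ha, hb]
  norm_cast
  have key : ∀ t : ℝ, 0 < t → t ≤ 1 →
      a + (w - p) ⬝ᵥ M *ᵥ (c - p) ≤ b + t * (1 / 2 * ((w - p) ⬝ᵥ M *ᵥ (w - p))) := by
    intro t ht ht1
    have h1 := (h (t • w + (1 - t) • p)).trans
      (add_le_add_left (hconv w p t ht.le ht1) _)
    rw [ha, hb] at h1
    norm_cast at h1
    have e1 : t • w + (1 - t) • p - c = t • (w - p) - (c - p) := by module
    have e2 : p - c = -(c - p) := by module
    rw [e1, e2] at h1
    simp only [mulVec_sub, mulVec_smul, mulVec_neg, dotProduct_sub, sub_dotProduct,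
      dotProduct_smul, smul_dotProduct, dotProduct_neg, neg_dotProduct, smul_eq_mul] at h1 ⊢
    have s1 := hM.dotProduct_mulVec_comm w p
    have s2 := hM.dotProduct_mulVec_comm w c
    have s3 := hM.dotProduct_mulVec_comm p c
    rw [s1, s2, s3] at h1 ⊢
    refine le_of_mul_le_mul_left ?_ ht
    linarith
  have hlim : Tendsto (fun t : ℝ => b + t * (1 / 2 * ((w - p) ⬝ᵥ M *ᵥ (w - p))))
      (nhdsWithin 0 (Set.Ioi 0)) (nhds b) := by
    have hc : Continuous fun t : ℝ => b + t * (1 / 2 * ((w - p) ⬝ᵥ M *ᵥ (w - p))) := by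
      fun_prop
    simpa using (hc.tendsto 0).mono_left nhdsWithin_le_nhds
  refine ge_of_tendsto hlim ?_
  filter_upwards [Ioc_mem_nhdsGT (zero_lt_one' ℝ)] with t ht using key t ht.1 ht.2

/-- Sufficiency of the first-order optimality condition for proximal points. -/
theorem SubgradAt.isProxPt {ι : Type*} [Fintype ι] {M : Matrix ι ι ℝ} (hM : M.PosDef)
    {φ : (ι → ℝ) → EReal} {c p : ι → ℝ} (h : SubgradAt φ p (M *ᵥ (c - p))) :
    IsProxPt M φ c p := by
  intro w
  refine le_trans ?_ (add_le_add_left (h w) _)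
  rw [add_assoc]
  refine add_le_add_right ?_ _
  norm_cast
  have hnn : 0 ≤ (w - p) ⬝ᵥ M *ᵥ (w - p) := by
    simpa using hM.posSemidef.dotProduct_mulVec_nonneg (w - p)
  have s1 := hM.isSymm_real.dotProduct_mulVec_comm w p
  have s2 := hM.isSymm_real.dotProduct_mulVec_comm w c
  have s3 := hM.isSymm_real.dotProduct_mulVec_comm p c
  simp only [mulVec_sub, dotProduct_sub, sub_dotProduct] at hnn ⊢
  linarith

/-- Subgradients are inverted by Fenchel conjugation. -/
theorem SubgradAt.conjE {ι : Type*} [Fintype ι] {φ : (ι → ℝ) → EReal} {p v : ι → ℝ}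
    (h : SubgradAt φ p v) (htop : φ p ≠ ⊤) (hbot : φ p ≠ ⊥) : SubgradAt (conjE φ) v p := by
  intro w
  obtain ⟨a, ha⟩ : ∃ a : ℝ, φ p = a := ⟨_, (EReal.coe_toReal htop hbot).symm⟩
  have hv : _root_.conjE φ v ≤ ((p ⬝ᵥ v - a : ℝ) : EReal) := by
    refine iSup_le fun q => ?_
    have hq := h q
    rw [ha, ← EReal.coe_add] at hq
    refine (EReal.sub_le_sub le_rfl hq).trans (le_of_eq ?_)
    rw [← EReal.coe_sub, sub_dotProduct]
    congr 1
    ring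
  have hw : ((p ⬝ᵥ w - a : ℝ) : EReal) ≤ _root_.conjE φ w := by
    rw [EReal.coe_sub, ← ha]
    exact le_iSup (fun q => ((q ⬝ᵥ w : ℝ) : EReal) - φ q) p
  refine (add_le_add_left hv _).trans (le_trans (le_of_eq ?_) hw)
  rw [← EReal.coe_add, sub_dotProduct, dotProduct_comm w p, dotProduct_comm v p]
  congr 1
  ring

/-- Moreau decomposition in the metric `M`. -/
theorem IsProxPt.conjE {ι : Type*} [Fintype ι] [DecidableEq ι] {M : Matrix ι ι ℝ}
    (hM : M.PosDef) {φ : (ι → ℝ) → EReal} (hφ : ProperE φ) (hconv : ConvexE φ)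
    {c p : ι → ℝ} (h : IsProxPt M φ c p) :
    IsProxPt M⁻¹ (conjE φ) (M *ᵥ c) (M *ᵥ (c - p)) := by
  refine SubgradAt.isProxPt hM.inv ?_
  have e : M⁻¹ *ᵥ (M *ᵥ c - M *ᵥ (c - p)) = p := by
    rw [← mulVec_sub, sub_sub_cancel, mulVec_mulVec,
      nonsing_inv_mul _ ((isUnit_iff_isUnit_det M).mp hM.isUnit), one_mulVec]
  rw [e]
  exact (h.subgradAt hM.isSymm_real hφ hconv).conjE (h.ne_top hφ) (hφ.2 p)

/-- under the change of variables `u^k = M1 x^k`,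
`y^{k+1} = u^k − Aᵀz^k − u^{k+1}`, the PrePDHG iteration
`x^{k+1} = prox^{M1}_f(x^k − M1⁻¹Aᵀz^k)`,
`z^{k+1} = prox^{M2}_{g*}(z^k + M2⁻¹A(2x^{k+1} − x^k))`
is equivalent to the preconditioned ADMM-type iteration on the dual:
`y^{k+1} = prox^{M1⁻¹}_{f*}(u^k − Aᵀz^k)`, `u^{k+1} = u^k − Aᵀz^k − y^{k+1}`, and
`z^{k+1} = prox^{M2}_{g*}(z^k + M2⁻¹AM1⁻¹(−Aᵀz^k − y^{k+1} + u^{k+1}))`. -/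
theorem prePDHG_equiv_dual_preconditioned_admm {n m : ℕ}
    (f : (Fin n → ℝ) → EReal) (g : (Fin m → ℝ) → EReal)
    (hfp : ProperE f) (hfc : LowerSemicontinuous f) (hfv : ConvexE f)
    (hgp : ProperE g) (hgc : LowerSemicontinuous g) (hgv : ConvexE g)
    (A : Matrix (Fin m) (Fin n) ℝ)
    (M1 : Matrix (Fin n) (Fin n) ℝ) (M2 : Matrix (Fin m) (Fin m) ℝ)
    (hM1 : M1.PosDef) (hM2 : M2.PosDef)
    (x : ℕ → Fin n → ℝ) (z : ℕ → Fin m → ℝ)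
    (hx : ∀ k, IsProxPt M1 f (x k - M1⁻¹.mulVec (Aᵀ.mulVec (z k))) (x (k + 1)))
    (hz : ∀ k, IsProxPt M2 (conjE g)
      (z k + M2⁻¹.mulVec (A.mulVec ((2 : ℝ) • x (k + 1) - x k))) (z (k + 1)))
    (u y : ℕ → Fin n → ℝ)
    (hu : ∀ k, u k = M1.mulVec (x k))
    (hy : ∀ k, y (k + 1) = u k - Aᵀ.mulVec (z k) - u (k + 1)) :
    ∀ k : ℕ,
      IsProxPt M1⁻¹ (conjE f) (u k - Aᵀ.mulVec (z k)) (y (k + 1)) ∧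
      u (k + 1) = u k - Aᵀ.mulVec (z k) - y (k + 1) ∧
      IsProxPt M2 (conjE g)
        (z k + M2⁻¹.mulVec (A.mulVec (M1⁻¹.mulVec
          (-(Aᵀ.mulVec (z k)) - y (k + 1) + u (k + 1))))) (z (k + 1)) := by
  intro k
  have hdet : IsUnit M1.det := (isUnit_iff_isUnit_det M1).mp hM1.isUnit
  have hinv (v : Fin n → ℝ) : M1 *ᵥ M1⁻¹ *ᵥ v = v := by
    rw [mulVec_mulVec, mul_nonsing_inv _ hdet, one_mulVec]
  refine ⟨?_, ?_, ?_⟩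
  · have h := (hx k).conjE hM1 hfp hfv
    rwa [mulVec_sub M1 _ (x (k + 1)), mulVec_sub, hinv, ← hu, ← hu, ← hy] at h
  · rw [hy]
    abel
  · have e : M1⁻¹ *ᵥ (-(Aᵀ *ᵥ z k) - y (k + 1) + u (k + 1)) =
        (2 : ℝ) • x (k + 1) - x k := by
      have e' : -(Aᵀ *ᵥ z k) - y (k + 1) + u (k + 1) =
          M1 *ᵥ ((2 : ℝ) • x (k + 1) - x k) := by
        rw [hy, mulVec_sub, mulVec_smul, ← hu, ← hu]
        module
      rw [e', mulVec_mulVec, nonsing_inv_mul _ hdet, one_mulVec]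
    rw [e]
    exact hz k
end
end
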